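/- Let ω₂ ≠ 0 and σ > 0, and define q̂(t) = 4 arctan(exp(√σ t)). Then for every phase ψ ∈ ℝ, σ ∫_ℝ (1 − cos(q̂(t))) cos(ω₂ t + ψ) dt = 2π ω₂ / sinh(π ω₂ / (2√σ)) · cos(ψ). -/

import Mathlib

open MeasureTheory Real

lemma Complex.Gamma_one_add_mul_I_mul_Gamma_one_sub_mul_I {y : ℝ} (hy : y ≠ 0) :
    Complex.Gamma (1 + y * Complex.I) * Complex.Gamma (1 - y * Complex.I) =
      (π * y / Real.sinh (π * y) : ℝ) := by
  have hyI : (y : ℂ) * Complex.I ≠ 0 := by simp [hy]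
  have hsinh : Complex.sinh (π * y) ≠ 0 := by
    rw [← Complex.ofReal_mul, ← Complex.ofReal_sinh, Complex.ofReal_ne_zero, Ne, Real.sinh_eq_zero]
    exact mul_ne_zero pi_ne_zero hy
  rw [add_comm, Complex.Gamma_add_one _ hyI, mul_assoc, Complex.Gamma_mul_Gamma_one_sub,
    ← mul_assoc (π : ℂ), Complex.sin_mul_I]
  push_cast
  field_simp

lemma Real.sigmoid_eq_exp_mul_one_sub_sigmoid (s : ℝ) :
    sigmoid s = exp s * (1 - sigmoid s) := by
  rw [← sigmoid_neg, ← sigmoid_mul_rexp_neg, mul_left_comm, ← exp_add, add_neg_cancel, exp_zero,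
    mul_one]

lemma sigmoid_cpow_mul_one_sub_sigmoid_cpow_neg (s : ℝ) (z : ℂ) :
    (sigmoid s : ℂ) ^ z * (1 - (sigmoid s : ℂ)) ^ (-z) = Complex.exp (s * z) := by
  have h1 : 0 < 1 - sigmoid s := sub_pos.2 (sigmoid_lt_one s)
  have hlog : Real.log (sigmoid s) = s + Real.log (1 - sigmoid s) := by
    conv_lhs => rw [sigmoid_eq_exp_mul_one_sub_sigmoid]
    rw [Real.log_mul (exp_pos s).ne' h1.ne', Real.log_exp]
  have h0' : (sigmoid s : ℂ) ≠ 0 := Complex.ofReal_ne_zero.2 (sigmoid_pos s).ne'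
  have h1' : ((1 - sigmoid s : ℝ) : ℂ) ≠ 0 := Complex.ofReal_ne_zero.2 h1.ne'
  rw [← Complex.ofReal_one, ← Complex.ofReal_sub, Complex.cpow_def_of_ne_zero h0',
    Complex.cpow_def_of_ne_zero h1', ← Complex.exp_add, ← Complex.ofReal_log (sigmoid_pos s).le,
    ← Complex.ofReal_log h1.le, hlog]
  congr 1
  push_cast
  ring

lemma abs_deriv_sigmoid_smul_betaIntegrand (y s : ℝ) :
    |sigmoid s * (1 - sigmoid s)| • ((sigmoid s : ℂ) ^ ((1 + y * Complex.I) - 1) *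
      (1 - (sigmoid s : ℂ)) ^ ((1 - y * Complex.I) - 1)) =
    (sigmoid s * (1 - sigmoid s) : ℝ) * Complex.exp (s * (y * Complex.I)) := by
  rw [add_sub_cancel_left, sub_sub_cancel_left, sigmoid_cpow_mul_one_sub_sigmoid_cpow_neg,
    abs_of_pos (mul_pos (sigmoid_pos s) (sub_pos.2 (sigmoid_lt_one s))), Complex.real_smul]

lemma integrable_deriv_sigmoid_mul_exp (y : ℝ) :
    Integrable fun s : ℝ ↦
      ((sigmoid s * (1 - sigmoid s) : ℝ) : ℂ) * Complex.exp (s * (y * Complex.I)) := by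
  have h := Complex.betaIntegral_convergent (u := 1 + y * Complex.I) (v := 1 - y * Complex.I)
    (by simp) (by simp)
  rw [intervalIntegrable_iff_integrableOn_Ioo_of_le zero_le_one, ← range_sigmoid,
    ← Set.image_univ, integrableOn_image_iff_integrableOn_abs_deriv_smul MeasurableSet.univ
      (fun s _ ↦ (hasDerivAt_sigmoid s).hasDerivWithinAt) sigmoid_injective.injOn,
    integrableOn_univ] at h
  simpa only [abs_deriv_sigmoid_smul_betaIntegrand] using h

lemma integral_deriv_sigmoid_mul_exp {y : ℝ} (hy : y ≠ 0) :
    ∫ s : ℝ, ((sigmoid s * (1 - sigmoid s) : ℝ) : ℂ) * Complex.exp (s * (y * Complex.I)) =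
      (π * y / Real.sinh (π * y) : ℝ) := by
  have h := Complex.Gamma_mul_Gamma_eq_betaIntegral (s := 1 + y * Complex.I)
    (t := 1 - y * Complex.I) (by simp) (by simp)
  rw [Complex.Gamma_one_add_mul_I_mul_Gamma_one_sub_mul_I hy, add_add_sub_cancel,
    Complex.Gamma_add_one 1 one_ne_zero, Complex.Gamma_one, one_mul, one_mul, Complex.betaIntegral,
    intervalIntegral.integral_of_le zero_le_one, integral_Ioc_eq_integral_Ioo, ← range_sigmoid,
    ← Set.image_univ, integral_image_eq_integral_abs_deriv_smul MeasurableSet.univ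
      (fun s _ ↦ (hasDerivAt_sigmoid s).hasDerivWithinAt) sigmoid_injective.injOn,
    setIntegral_univ] at h
  simpa only [abs_deriv_sigmoid_smul_betaIntegrand] using h.symm

lemma integral_deriv_sigmoid_mul_cos {y : ℝ} (hy : y ≠ 0) (ψ : ℝ) :
    ∫ s : ℝ, sigmoid s * (1 - sigmoid s) * Real.cos (y * s + ψ) =
      π * y / Real.sinh (π * y) * Real.cos ψ := by
  have hre := integral_re ((integrable_deriv_sigmoid_mul_exp y).mul_const
    (Complex.exp (ψ * Complex.I)))
  rw [integral_mul_const, integral_deriv_sigmoid_mul_exp hy] at hre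
  simp only [RCLike.re_eq_complex_re, mul_assoc, Complex.re_ofReal_mul, ← Complex.exp_add,
    Complex.exp_ofReal_mul_I_re] at hre
  rw [← hre]
  refine integral_congr_ae (.of_forall fun s ↦ ?_)
  have : (s * (y * Complex.I) + ψ * Complex.I : ℂ) = (y * s + ψ : ℝ) * Complex.I := by
    push_cast
    ring
  simp only [this, Complex.exp_ofReal_mul_I_re, mul_assoc]

lemma one_sub_cos_four_mul_arctan_exp (x : ℝ) :
    1 - Real.cos (4 * Real.arctan (Real.exp x)) =
      8 * (sigmoid (2 * x) * (1 - sigmoid (2 * x))) := by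
  have hsq : Real.exp (-(2 * x)) = (Real.exp x ^ 2)⁻¹ := by
    rw [Real.exp_neg, ← Real.exp_nat_mul]
    norm_num
  have hpos : 0 < Real.exp x := Real.exp_pos x
  have hden : 1 + Real.exp x ^ 2 ≠ 0 := by positivity
  rw [show 4 * Real.arctan (Real.exp x) = 2 * (2 * Real.arctan (Real.exp x)) by ring,
    Real.cos_two_mul, Real.cos_two_mul, Real.cos_sq_arctan, sigmoid_def, hsq]
  field_simp
  ring

/-- Melnikov integral along the pendulum separatrix:
`σ ∫_ℝ (1 − cos q̂(t)) cos(ω₂ t + ψ) dt = 2π ω₂ / sinh(π ω₂/(2√σ)) · cos ψ`. -/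
theorem melnikov_integral (σ ω₂ ψ : ℝ) (hσ : 0 < σ) (hω : ω₂ ≠ 0) :
    σ * (∫ t : ℝ,
        (1 - Real.cos (4 * Real.arctan (Real.exp (Real.sqrt σ * t)))) *
          Real.cos (ω₂ * t + ψ)) =
      2 * π * ω₂ / Real.sinh (π * ω₂ / (2 * Real.sqrt σ)) * Real.cos ψ := by
  have ha : 0 < Real.sqrt σ := Real.sqrt_pos.2 hσ
  have hσa : Real.sqrt σ ^ 2 = σ := Real.sq_sqrt hσ.le
  generalize Real.sqrt σ = a at *
  subst hσa
  have hy : ω₂ / (2 * a) ≠ 0 := by positivity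
  have hintegrand (t : ℝ) :
      (1 - Real.cos (4 * Real.arctan (Real.exp (a * t)))) * Real.cos (ω₂ * t + ψ) =
      8 * (sigmoid (2 * a * t) * (1 - sigmoid (2 * a * t)) *
        Real.cos (ω₂ / (2 * a) * (2 * a * t) + ψ)) := by
    rw [one_sub_cos_four_mul_arctan_exp, ← mul_assoc 2 a t, mul_assoc 8, ← mul_assoc _ (2 * a) t,
      div_mul_cancel₀ _ (by positivity)]
  simp_rw [hintegrand]
  rw [integral_const_mul, Measure.integral_comp_mul_left
      (fun s ↦ sigmoid s * (1 - sigmoid s) * Real.cos (ω₂ / (2 * a) * s + ψ)) (2 * a),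
    integral_deriv_sigmoid_mul_cos hy, abs_of_pos (by positivity), smul_eq_mul, ← mul_div_assoc]
  field_simp
  ring
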